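/- Let Γ be a countable group. The set of α ∈ A(Γ) admitting at least one α-invariant Borel probability measure on X is closed in A(Γ), and the set of uniquely ergodic α ∈ A(Γ) (those with exactly one α-invariant Borel probability measure) is a Gδ subset of A(Γ). -/

import Mathlib

open MeasureTheory Set
open scoped ENNReal

/-! Preliminary definitions: the clopen type semigroup of an action of a group `Γ`
by homeomorphisms on a topological space `X`, invariant measures, dynamical comparison,
topological full groups, and the topology on spaces of actions. -/

/-- The group of self-homeomorphisms of `X`, with `(g * h) x = g (h x)`. -/
instance homeoGroup (X : Type*) [TopologicalSpace X] : Group (X ≃ₜ X) where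
  mul g h := h.trans g
  one := Homeomorph.refl X
  inv := Homeomorph.symm
  mul_assoc a b c := Homeomorph.ext fun _ => rfl
  one_mul a := Homeomorph.ext fun _ => rfl
  mul_one a := Homeomorph.ext fun _ => rfl
  inv_mul_cancel a := Homeomorph.ext fun x => a.symm_apply_apply x

/-- The Cantor space `{0,1}^ℕ`. -/
abbrev Cantor : Type := ℕ → Bool

section Defs

variable {Γ : Type*} [Group Γ] {X : Type*} [TopologicalSpace X]

/-- A left-invariant finitely additive probability measure on (the power set of) `Γ`,
with values in `[0,1]`. `Γ` is amenable iff such a measure exists. -/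
def IsInvFapm {Γ : Type*} [Group Γ] (m : Set Γ → ℝ) : Prop :=
  (∀ E : Set Γ, 0 ≤ m E) ∧ (∀ E : Set Γ, m E ≤ 1) ∧ m Set.univ = 1 ∧
  (∀ E F : Set Γ, Disjoint E F → m (E ∪ F) = m E + m F) ∧
  (∀ (γ : Γ) (E : Set Γ), m ((γ * ·) '' E) = m E)

/-- The action of `γ ∈ Γ` on continuous `ℕ`-valued functions: `(γ · f)(x) = f(γ⁻¹ · x)`. -/
def actC (α : Γ →* X ≃ₜ X) (γ : Γ) (f : C(X, ℕ)) : C(X, ℕ) :=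
  f.comp (α γ⁻¹)

/-- The equidecomposability relation `∼` on `C(X, ℕ)`: `f ∼ g` iff `f = h₁ + ⋯ + hₙ`
and `g = γ₁·h₁ + ⋯ + γₙ·hₙ` for some `hᵢ ∈ C(X,ℕ)`, `γᵢ ∈ Γ`. -/
def TypeRel (α : Γ →* X ≃ₜ X) (f g : C(X, ℕ)) : Prop :=
  ∃ (n : ℕ) (h : Fin n → C(X, ℕ)) (γ : Fin n → Γ),
    f = ∑ i, h i ∧ g = ∑ i, actC α (γ i) (h i)

/-- The additive congruence on `C(X, ℕ)` generated by `∼` (since `∼` is itself an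
additive congruence, this is just `∼`). -/
def typeCon (α : Γ →* X ≃ₜ X) : AddCon C(X, ℕ) := addConGen (TypeRel α)

/-- The clopen type semigroup `T(α) = C(X,ℕ)/∼`. -/
abbrev TypeSemigroup (α : Γ →* X ≃ₜ X) := (typeCon α).Quotient

/-- The class `[f] ∈ T(α)` of `f ∈ C(X, ℕ)`. -/
def cls (α : Γ →* X ≃ₜ X) (f : C(X, ℕ)) : TypeSemigroup α := (typeCon α).toQuotient f

/-- The algebraic preorder on `T(α)`: `a ≤ b` iff `a + c = b` for some `c`. -/
def tle (α : Γ →* X ≃ₜ X) (a b : TypeSemigroup α) : Prop := ∃ c, a + c = b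

/-- `T(α)` is unperforated: `n • a ≤ n • b` implies `a ≤ b` for all `n ≥ 1`. -/
def IsUnperforated (α : Γ →* X ≃ₜ X) : Prop :=
  ∀ (a b : TypeSemigroup α) (n : ℕ), 1 ≤ n → tle α (n • a) (n • b) → tle α a b

/-- `T(α)` is almost unperforated: `(n+1) • a ≤ n • b` implies `a ≤ b`. -/
def IsAlmostUnperforated (α : Γ →* X ≃ₜ X) : Prop :=
  ∀ (a b : TypeSemigroup α) (n : ℕ), tle α ((n + 1) • a) (n • b) → tle α a b

/-- `T(α)` is cancellative: `a + b = a + c` implies `b = c`. -/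
def IsCancellative (α : Γ →* X ≃ₜ X) : Prop :=
  ∀ a b c : TypeSemigroup α, a + b = a + c → b = c

/-- The algebraic preorder on `T(α)` is a partial order, i.e. it is antisymmetric. -/
def TleAntisymm (α : Γ →* X ≃ₜ X) : Prop :=
  ∀ a b : TypeSemigroup α, tle α a b → tle α b a → a = b

/-- `b` is an order unit of `T(α)`: every `a` satisfies `a ≤ k • b` for some `k ∈ ℕ`. -/
def IsOrderUnit (α : Γ →* X ≃ₜ X) (b : TypeSemigroup α) : Prop :=
  ∀ a : TypeSemigroup α, ∃ k : ℕ, tle α a (k • b)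

/-- A state on `T(α)`: an additive map to `[0,∞]` sending `0` to `0`. -/
def IsState (α : Γ →* X ≃ₜ X) (ν : TypeSemigroup α → ℝ≥0∞) : Prop :=
  ν 0 = 0 ∧ ∀ a b : TypeSemigroup α, ν (a + b) = ν a + ν b

/-- `M(α)`: the set of `Γ`-invariant Radon (regular Borel) probability measures on `X`. -/
def invRadon (α : Γ →* X ≃ₜ X) : Set (@Measure X (borel X)) :=
  letI : MeasurableSpace X := borel X
  {μ : Measure X | IsProbabilityMeasure μ ∧ μ.Regular ∧ ∀ γ : Γ, Measure.map ⇑(α γ) μ = μ}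

/-- The set of `Γ`-invariant Borel probability measures on `X`. -/
def invBorel (α : Γ →* X ≃ₜ X) : Set (@Measure X (borel X)) :=
  letI : MeasurableSpace X := borel X
  {μ : Measure X | IsProbabilityMeasure μ ∧ ∀ γ : Γ, Measure.map ⇑(α γ) μ = μ}

/-- `μ([f]) = ∫ f dμ`, the value of (the state associated with) a measure on the class of
`f ∈ C(X, ℕ)`. -/
noncomputable def intOf {X : Type*} [TopologicalSpace X] (μ : @Measure X (borel X))
    (f : C(X, ℕ)) : ℝ :=
  letI : MeasurableSpace X := borel X
  ∫ x, (f x : ℝ) ∂μ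

/-- `A` is subequidecomposable to `B`: there are a partition `A = A₁ ⊔ ⋯ ⊔ Aₙ` into clopen
sets and `γ₁, …, γₙ ∈ Γ` with `γ₁A₁, …, γₙAₙ` pairwise disjoint and contained in `B`. -/
def Subequidecomposable (α : Γ →* X ≃ₜ X) (A B : Set X) : Prop :=
  ∃ (n : ℕ) (P : Fin n → Set X) (γ : Fin n → Γ),
    (∀ i, IsClopen (P i)) ∧ (Pairwise fun i j => Disjoint (P i) (P j)) ∧
    (⋃ i, P i) = A ∧
    (Pairwise fun i j => Disjoint (⇑(α (γ i)) '' P i) (⇑(α (γ j)) '' P j)) ∧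
    ∀ i, ⇑(α (γ i)) '' P i ⊆ B

/-- Dynamical comparison (with respect to invariant Radon probability measures): for all
clopen `A`, `B` with `B` nonempty and `μ(A) < μ(B)` for every `μ ∈ M(α)`, `A` is
subequidecomposable to `B`. -/
def DynComparison (α : Γ →* X ≃ₜ X) : Prop :=
  ∀ A B : Set X, IsClopen A → IsClopen B → B.Nonempty →
    (∀ μ ∈ invRadon α, μ A < μ B) → Subequidecomposable α A B

/-- Dynamical comparison (with respect to invariant Borel probability measures). -/
def DynComparisonBorel (α : Γ →* X ≃ₜ X) : Prop :=
  ∀ A B : Set X, IsClopen A → IsClopen B → B.Nonempty →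
    (∀ μ ∈ invBorel α, μ A < μ B) → Subequidecomposable α A B

/-- The action `α` is minimal: the only closed invariant subsets are `∅` and `X`. -/
def IsMinimalAction (α : Γ →* X ≃ₜ X) : Prop :=
  ∀ F : Set X, IsClosed F → (∀ γ : Γ, ⇑(α γ) '' F ⊆ F) → F = ∅ ∨ F = Set.univ

/-- Membership in the topological full group `⟦α⟧`: `g` coincides with elements of the
action on the pieces of a finite clopen partition of `X`. -/
def InTopFullGroup (α : Γ →* X ≃ₜ X) (g : X ≃ₜ X) : Prop :=
  ∃ (n : ℕ) (P : Fin n → Set X) (γ : Fin n → Γ),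
    (∀ i, IsClopen (P i)) ∧ (Pairwise fun i j => Disjoint (P i) (P j)) ∧
    (⋃ i, P i) = Set.univ ∧ ∀ i, ∀ x ∈ P i, g x = α (γ i) x

/-- `⟦α⟧` admits a dense locally finite subgroup: there is a subgroup `Λ` of `Homeo(X)`
contained in `⟦α⟧`, locally finite (all its finitely generated subgroups are finite), and
dense in `⟦α⟧` for the topology whose basic neighborhoods of `h` are
`{g : g A = h A for all A ∈ 𝒜}`, `𝒜` ranging over finite clopen partitions of `X`. -/
def HasDenseLocallyFiniteSubgroup (α : Γ →* X ≃ₜ X) : Prop :=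
  ∃ Λ : Subgroup (X ≃ₜ X),
    ((Λ : Set (X ≃ₜ X)) ⊆ {g | InTopFullGroup α g}) ∧
    (∀ s : Finset (X ≃ₜ X), (s : Set (X ≃ₜ X)) ⊆ (Λ : Set (X ≃ₜ X)) →
      ((Subgroup.closure (s : Set (X ≃ₜ X)) : Subgroup (X ≃ₜ X)) : Set (X ≃ₜ X)).Finite) ∧
    ∀ g : X ≃ₜ X, InTopFullGroup α g →
      ∀ (n : ℕ) (P : Fin n → Set X), (∀ i, IsClopen (P i)) →
        (Pairwise fun i j => Disjoint (P i) (P j)) → (⋃ i, P i) = Set.univ →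
        ∃ l ∈ Λ, ∀ i, ⇑l '' P i = ⇑g '' P i

end Defs

/-- The topology on `Homeo(X)` whose basic neighborhoods of `h` are the sets
`{g : g A = h A for all A ∈ 𝒜}`, for `𝒜` a finite clopen partition of `X`; equivalently,
the topology generated by the sets `{g : g '' A = B}` for `A`, `B` clopen. -/
def homeoTop (X : Type*) [TopologicalSpace X] : TopologicalSpace (X ≃ₜ X) :=
  TopologicalSpace.generateFrom
    {U | ∃ A B : Set X, IsClopen A ∧ IsClopen B ∧ U = {g : X ≃ₜ X | ⇑g '' A = B}}

/-- The topology on the space `A(Γ)` of actions of `Γ` on `X`, induced from the product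
topology on `Homeo(X)^Γ`. -/
def actionTop (Γ : Type*) [Group Γ] (X : Type*) [TopologicalSpace X] :
    TopologicalSpace (Γ →* (X ≃ₜ X)) :=
  letI := homeoTop X
  TopologicalSpace.induced (fun φ : Γ →* (X ≃ₜ X) => ⇑φ) Pi.topologicalSpace

section Helpers

open TopologicalSpace Filter Topology

variable {Γ : Type*} [Group Γ] {X : Type*} [TopologicalSpace X]

theorem aux_open (γ : Γ) {A B : Set X} (hA : IsClopen A) (hB : IsClopen B) :
    IsOpen[actionTop Γ X] {α : Γ →* (X ≃ₜ X) | ⇑(α γ) '' A = B} := by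
  letI := homeoTop X
  letI := actionTop Γ X
  have h1 : IsOpen {g : X ≃ₜ X | ⇑g '' A = B} :=
    isOpen_generateFrom_of_mem ⟨A, B, hA, hB, rfl⟩
  have h2 : Continuous (fun α : Γ →* (X ≃ₜ X) => α γ) :=
    (continuous_apply γ).comp continuous_induced_dom
  exact h1.preimage h2

theorem aux_img (g : X ≃ₜ X) {A : Set X} (hA : IsClopen A) : IsClopen (⇑g '' A) :=
  ⟨g.isClosed_image.2 hA.1, g.isOpen_image.2 hA.2⟩

theorem aux_le (t : TopologicalSpace (Γ →* (X ≃ₜ X)))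
    (h : ∀ (γ : Γ) (A B : Set X), IsClopen A → IsClopen B →
      IsOpen {α : Γ →* (X ≃ₜ X) | ⇑(α γ) '' A = B}) : t ≤ actionTop Γ X := by
  letI := homeoTop X
  have h1 : Continuous (fun φ : Γ →* (X ≃ₜ X) => (⇑φ : Γ → (X ≃ₜ X))) := by
    refine continuous_pi fun γ => ?_
    refine continuous_generateFrom_iff.2 ?_
    rintro U ⟨A, B, hA, hB, rfl⟩
    exact h γ A B hA hB
  exact continuous_iff_le_induced.1 h1

def auxImg (α : Γ →* (X ≃ₜ X)) (p : Γ × Clopens X) : Clopens X :=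
  ⟨⇑(α p.1) '' p.2, aux_img (α p.1) p.2.isClopen⟩

theorem aux_metr [Countable Γ] [Countable (Clopens X)] :
    @PseudoMetrizableSpace (Γ →* (X ≃ₜ X)) (actionTop Γ X) := by
  letI : TopologicalSpace (Clopens X) := ⊥
  haveI : DiscreteTopology (Clopens X) := ⟨rfl⟩
  letI := actionTop Γ X
  have hind : IsInducing (auxImg : (Γ →* (X ≃ₜ X)) → (Γ × Clopens X → Clopens X)) := by
    refine ⟨le_antisymm ?_ ?_⟩
    · rw [← continuous_iff_le_induced]
      refine continuous_pi fun p => ?_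
      rw [continuous_discrete_rng]
      intro B
      convert aux_open (Γ := Γ) p.1 p.2.isClopen B.isClopen using 1
      ext α
      exact SetLike.ext'_iff
    · refine aux_le _ fun γ A B hA hB => ?_
      refine isOpen_induced_iff.2
        ⟨{f | f (γ, ⟨A, hA⟩) = ⟨B, hB⟩}, ?_, ?_⟩
      · have hc : Continuous (fun f : Γ × Clopens X → Clopens X => f (γ, ⟨A, hA⟩)) :=
          continuous_apply _
        exact (isOpen_discrete {(⟨B, hB⟩ : Clopens X)}).preimage hc
      · ext α
        exact SetLike.ext'_iff
  exact hind.pseudoMetrizableSpace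

variable [CompactSpace X] [T2Space X] [TotallyDisconnectedSpace X] [SecondCountableTopology X]

theorem aux_ext [MeasurableSpace X] [BorelSpace X] (μ ν : Measure X) [IsProbabilityMeasure μ]
    [IsProbabilityMeasure ν] (h : ∀ C : Set X, IsClopen C → μ C = ν C) : μ = ν := by
  refine ext_of_generate_finite {s : Set X | IsClopen s} ?_ ?_ ?_ (by simp)
  · rw [BorelSpace.measurable_eq (α := X)]
    exact isTopologicalBasis_isClopen.borel_eq_generateFrom
  · intro s hs t ht _
    exact IsClopen.inter hs ht
  · intro s hs
    exact h s hs

theorem aux_inv_iff [MeasurableSpace X] [BorelSpace X] (α : Γ →* (X ≃ₜ X))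
    (μ : Measure X) [IsProbabilityMeasure μ] :
    (∀ γ : Γ, Measure.map ⇑(α γ) μ = μ) ↔
      ∀ (γ : Γ) (C : Clopens X), μ (⇑(α γ) '' C) = μ C := by
  constructor
  · intro h γ C
    conv_lhs => rw [← h γ]
    rw [Measure.map_apply (α γ).continuous.measurable
      (aux_img (α γ) C.isClopen).2.measurableSet,
      (α γ).injective.preimage_image]
  · intro h γ
    haveI : IsProbabilityMeasure (Measure.map ⇑(α γ) μ) :=
      Measure.isProbabilityMeasure_map (α γ).continuous.aemeasurable
    refine aux_ext _ _ fun C hC => ?_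
    rw [Measure.map_apply (α γ).continuous.measurable hC.2.measurableSet]
    have := h γ ⟨⇑(α γ) ⁻¹' C, hC.preimage (α γ).continuous⟩
    simp only [Clopens.coe_mk] at this
    rw [← this, (α γ).surjective.image_preimage]

theorem aux_cont [MeasurableSpace X] [BorelSpace X] {C : Set X} (hC : IsClopen C) :
    Continuous (fun μ : ProbabilityMeasure X => μ C) := by
  letI := metrizableSpaceMetric X
  rw [continuous_iff_continuousAt]
  intro μ
  exact ProbabilityMeasure.tendsto_measure_of_null_frontier_of_tendsto tendsto_id
    (by simp [hC.frontier_eq])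

theorem aux_closed [MeasurableSpace X] [BorelSpace X] :
    letI := actionTop Γ X
    IsClosed {p : (Γ →* (X ≃ₜ X)) × ProbabilityMeasure X |
      ∀ (γ : Γ) (C : Clopens X), p.2 (⇑(p.1 γ) '' C) = p.2 C} := by
  letI := actionTop Γ X
  simp only [ofPred_forall]
  refine isClosed_iInter fun γ => isClosed_iInter fun C => ?_
  refine isClosed_eq ?_ ((aux_cont C.isClopen).comp continuous_snd)
  rw [continuous_iff_continuousAt]
  rintro ⟨α, μ⟩
  have hB : IsClopen (⇑(α γ) '' (C : Set X)) := aux_img (α γ) C.isClopen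
  have h1 : ContinuousAt (fun p : (Γ →* (X ≃ₜ X)) × ProbabilityMeasure X =>
      p.2 (⇑(α γ) '' (C : Set X))) (α, μ) :=
    ((aux_cont hB).comp continuous_snd).continuousAt
  refine h1.congr ?_
  have h2 : IsOpen {p : (Γ →* (X ≃ₜ X)) × ProbabilityMeasure X |
      ⇑(p.1 γ) '' (C : Set X) = ⇑(α γ) '' (C : Set X)} :=
    (aux_open (Γ := Γ) γ C.isClopen hB).preimage continuous_fst
  filter_upwards [h2.mem_nhds rfl] with p hp
  rw [hp]

theorem aux_mem [MeasurableSpace X] [BorelSpace X] (α : Γ →* (X ≃ₜ X))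
    (μ : ProbabilityMeasure X) :
    (∀ (γ : Γ) (C : Clopens X), μ (⇑(α γ) '' C) = μ C) ↔
      ∀ γ : Γ, Measure.map ⇑(α γ) (μ : Measure X) = μ := by
  rw [aux_inv_iff]
  refine forall_congr' fun γ => forall_congr' fun C => ?_
  rw [← ProbabilityMeasure.ennreal_coeFn_eq_coeFn_toMeasure,
    ← ProbabilityMeasure.ennreal_coeFn_eq_coeFn_toMeasure, ENNReal.coe_inj]

theorem aux_main [Countable Γ] :
    letI := actionTop Γ X
    (IsClosed {α : Γ →* (X ≃ₜ X) | (invBorel α).Nonempty} ∧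
     IsGδ {α : Γ →* (X ≃ₜ X) | ∃! μ, μ ∈ invBorel α}) := by
  letI := actionTop Γ X
  letI : MeasurableSpace X := borel X
  haveI : BorelSpace X := ⟨rfl⟩
  haveI : Countable (Clopens X) := Clopens.countable_iff_secondCountable.2 inferInstance
  haveI := aux_metr (Γ := Γ) (X := X)
  letI : PseudoMetricSpace (Γ →* (X ≃ₜ X)) := pseudoMetrizableSpacePseudoMetric _
  let R : Set ((Γ →* (X ≃ₜ X)) × ProbabilityMeasure X) := {p |
      ∀ (γ : Γ) (C : Clopens X), p.2 (⇑(p.1 γ) '' C) = p.2 C}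
  have hR : IsClosed R := aux_closed
  have h1 : IsClosed {α : Γ →* (X ≃ₜ X) | (invBorel α).Nonempty} := by
    convert isClosedMap_fst_of_compactSpace _ hR using 1
    ext α
    constructor
    · rintro ⟨μ, hp, hμ⟩
      exact ⟨(α, ⟨μ, hp⟩), (aux_mem α ⟨μ, hp⟩).2 hμ, rfl⟩
    · rintro ⟨⟨β, μ⟩, h, rfl⟩
      exact ⟨μ, inferInstance, (aux_mem β μ).1 h⟩
  refine ⟨h1, ?_⟩
  let S : Clopens X → ℕ → Set ((Γ →* (X ≃ₜ X)) × ProbabilityMeasure X × ProbabilityMeasure X) :=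
    fun C n => {p | (p.1, p.2.1) ∈ R ∧ (p.1, p.2.2) ∈ R ∧
      (1 : ℝ) / ((n : ℝ) + 1) ≤ dist (p.2.1 C) (p.2.2 C)}
  have hS : ∀ C n, IsClosed (S C n) := by
    intro C n
    have hc := aux_cont C.isClopen
    refine IsClosed.inter (hR.preimage (f := fun p : (Γ →* (X ≃ₜ X)) × ProbabilityMeasure X ×
        ProbabilityMeasure X => (p.1, p.2.1)) (by fun_prop))
      (IsClosed.inter (hR.preimage (f := fun p : (Γ →* (X ≃ₜ X)) × ProbabilityMeasure X ×
        ProbabilityMeasure X => (p.1, p.2.2)) (by fun_prop)) ?_)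
    exact isClosed_le continuous_const
      ((hc.comp (continuous_fst.comp continuous_snd)).dist
        (hc.comp (continuous_snd.comp continuous_snd)))
  have hEq : {α : Γ →* (X ≃ₜ X) | ∃! μ, μ ∈ invBorel α} =
      {α : Γ →* (X ≃ₜ X) | (invBorel α).Nonempty} ∩ ⋂ C, ⋂ n, (Prod.fst '' S C n)ᶜ := by
    ext α
    simp only [mem_inter_iff, mem_iInter, mem_compl_iff, mem_ofPred_eq]
    constructor
    · rintro ⟨μ, hμ, hu⟩
      refine ⟨⟨μ, hμ⟩, ?_⟩
      rintro C n ⟨⟨β, ν₁, ν₂⟩, ⟨hν₁, hν₂, hd⟩, rfl⟩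
      have e1 := hu ν₁ ⟨inferInstance, (aux_mem _ _).1 hν₁⟩
      have e2 := hu ν₂ ⟨inferInstance, (aux_mem _ _).1 hν₂⟩
      have e : ν₁ = ν₂ := Subtype.ext (e1.trans e2.symm)
      subst e
      have : (0 : ℝ) < 1 / ((n : ℝ) + 1) := by positivity
      simp only [dist_self] at hd
      linarith
    · rintro ⟨⟨μ, hμ⟩, h⟩
      refine ⟨μ, hμ, ?_⟩
      intro ν hν
      obtain ⟨hμp, hμi⟩ := hμ
      obtain ⟨hνp, hνi⟩ := hν
      refine aux_ext ν μ fun C hC => ?_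
      by_contra hne
      let μ' : ProbabilityMeasure X := ⟨μ, hμp⟩
      let ν' : ProbabilityMeasure X := ⟨ν, hνp⟩
      have hne' : ν' C ≠ μ' C := by
        intro he
        apply hne
        have := congrArg (fun x : NNReal => (x : ℝ≥0∞)) he
        simp only [ProbabilityMeasure.ennreal_coeFn_eq_coeFn_toMeasure] at this
        exact this
      obtain ⟨n, hn⟩ := exists_nat_one_div_lt (dist_pos.2 hne')
      exact h ⟨C, hC⟩ n ⟨(α, ν', μ'), ⟨(aux_mem α ν').2 hνi, (aux_mem α μ').2 hμi, hn.le⟩, rfl⟩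
  rw [hEq]
  refine h1.isGδ.inter (IsGδ.iInter fun C => IsGδ.iInter fun n => IsOpen.isGδ ?_)
  exact (isClosedMap_fst_of_compactSpace _ (hS C n)).isOpen_compl

end Helpers

/-- The set of actions of `Γ` on the Cantor space admitting an invariant
Borel probability measure is closed in `A(Γ)`, and the set of uniquely ergodic actions is a
`Gδ` subset of `A(Γ)`. -/
theorem stmt18 (Γ : Type*) [Group Γ] [Countable Γ] :
    letI := actionTop Γ Cantor
    (IsClosed {α : Γ →* (Cantor ≃ₜ Cantor) | (invBorel α).Nonempty} ∧
     IsGδ {α : Γ →* (Cantor ≃ₜ Cantor) | ∃! μ, μ ∈ invBorel α}) := by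
  exact aux_main
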